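/- arXiv:1908.05173 — 4 statements merged into one kernel-verified Lean document; each statement's English description precedes it below -/
import Mathlib

section
/- Let f ∈ ℝ[x,y] be of the form x³ + x·y² + E·x² + F·x·y + G·y² + λ, where E, F, G ∈ ℝ and λ ∈ ℝ[x,y] has total degree at most 1. Then there exist an affine automorphism θ ∈ Γ₂(ℝ) and a nonzero real number c such that θ(f) = c·g, where g is one of the following polynomials: x³ + x·y² + x² + H·x + I·y + J with H, J ∈ ℝ and I ≥ 0; x³ + x·y² + y + H·x + J with H ∈ ℝ and J ≥ 0; x³ + x·y² + ε·x + J with ε ∈ {1, −1} and J ≥ 0; x³ + x·y² + 1; or x³ + x·y². -/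
open MvPolynomial

/-- The polynomial ring `ℝ[x,y]`, realized as `MvPolynomial (Fin 2) ℝ`
with `X 0 = x` and `X 1 = y`. -/
abbrev P2 : Type := MvPolynomial (Fin 2) ℝ

/-- `f ∼ g` : there are an affine automorphism `θ ∈ Γ₂(ℝ)` (a ring automorphism
of `ℝ[x,y]` sending `x` and `y` to polynomials of total degree at most 1)
and a nonzero `c ∈ ℝ` with `θ f = c • g`. -/
def AffEquiv (f g : P2) : Prop :=
  ∃ θ : P2 ≃+* P2, (θ (X 0)).totalDegree ≤ 1 ∧ (θ (X 1)).totalDegree ≤ 1 ∧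
    ∃ c : ℝ, c ≠ 0 ∧ θ f = C c * g

/-- `f ≈ g` : there are a ring automorphism `φ` of `ℝ[x,y]` and a nonzero
`c ∈ ℝ` with `φ f = c • g`. -/
def AutEquiv (f g : P2) : Prop :=
  ∃ φ : P2 ≃+* P2, ∃ c : ℝ, c ≠ 0 ∧ φ f = C c * g

/-- The table entries with canonical form `x³ + x·y²`. -/
def FamA (p : P2) : Prop :=
  (∃ H I J : ℝ, 0 ≤ I ∧
    p = X 0 ^ 3 + X 0 * X 1 ^ 2 + X 0 ^ 2 + C H * X 0 + C I * X 1 + C J) ∨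
  (∃ H J : ℝ, 0 ≤ J ∧
    p = X 0 ^ 3 + X 0 * X 1 ^ 2 + X 1 + C H * X 0 + C J) ∨
  (∃ e J : ℝ, (e = 1 ∨ e = -1) ∧ 0 ≤ J ∧
    p = X 0 ^ 3 + X 0 * X 1 ^ 2 + C e * X 0 + C J) ∨
  p = X 0 ^ 3 + X 0 * X 1 ^ 2 + 1 ∨
  p = X 0 ^ 3 + X 0 * X 1 ^ 2

/-- The affine substitution `x ↦ s x + p`, `y ↦ t y + q`. -/
noncomputable def diagAffine (s p t q : ℝ) : P2 →ₐ[ℝ] P2 :=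
  aeval ![C s * X 0 + C p, C t * X 1 + C q]

@[simp]
lemma diagAffine_X_zero (s p t q : ℝ) : diagAffine s p t q (X 0) = C s * X 0 + C p := by
  simp [diagAffine]

@[simp]
lemma diagAffine_X_one (s p t q : ℝ) : diagAffine s p t q (X 1) = C t * X 1 + C q := by
  simp [diagAffine]

@[simp]
lemma diagAffine_C (s p t q r : ℝ) : diagAffine s p t q (C r) = C r :=
  algHom_C _ _

lemma diagAffine_comp {s p t q s' p' t' q' : ℝ} (hs : s * s' = 1) (ht : t * t' = 1)
    (hp : s * p' + p = 0) (hq : t * q' + q = 0) :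
    (diagAffine s' p' t' q').comp (diagAffine s p t q) = AlgHom.id ℝ P2 := by
  have hs : (C s * C s' : P2) = 1 := by rw [← C_mul, hs, C_1]
  have ht : (C t * C t' : P2) = 1 := by rw [← C_mul, ht, C_1]
  have hp : (C s * C p' + C p : P2) = 0 := by rw [← C_mul, ← C_add, hp, C_0]
  have hq : (C t * C q' + C q : P2) = 0 := by rw [← C_mul, ← C_add, hq, C_0]
  ext1 i
  fin_cases i
  · simp
    linear_combination X 0 * hs + hp
  · simp
    linear_combination X 1 * ht + hq

lemma totalDegree_C_mul_X_add_C_le (r p : ℝ) (i : Fin 2) :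
    (C r * X i + C p : P2).totalDegree ≤ 1 := by
  refine (totalDegree_add _ _).trans (max_le ?_ (by simp))
  exact (totalDegree_mul _ _).trans (by simp)

lemma AffEquiv.of_diagAffine {f g : P2} {s p t q c : ℝ} (hs : s ≠ 0) (ht : t ≠ 0) (hc : c ≠ 0)
    (h : diagAffine s p t q f = C c * g) : AffEquiv f g := by
  refine ⟨(AlgEquiv.ofAlgHom (diagAffine s p t q) (diagAffine s⁻¹ (-p / s) t⁻¹ (-q / t))
    (diagAffine_comp ?_ ?_ ?_ ?_) (diagAffine_comp ?_ ?_ ?_ ?_)).toRingEquiv,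
    ?_, ?_, c, hc, h⟩
  any_goals field_simp
  any_goals ring1
  · exact (congrArg totalDegree (diagAffine_X_zero s p t q)).trans_le
      (totalDegree_C_mul_X_add_C_le _ _ _)
  · exact (congrArg totalDegree (diagAffine_X_one s p t q)).trans_le
      (totalDegree_C_mul_X_add_C_le _ _ _)

lemma exists_eq_of_totalDegree_le_one {p : P2} (hp : p.totalDegree ≤ 1) :
    ∃ a b d : ℝ, p = C a * X 0 + C b * X 1 + C d := by
  refine ⟨p.coeff (Finsupp.single 0 1), p.coeff (Finsupp.single 1 1), p.coeff 0, ?_⟩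
  ext m
  have hm : m = Finsupp.single 0 (m 0) + Finsupp.single 1 (m 1) := by
    ext i; fin_cases i <;> simp
  generalize m 0 = u at hm
  generalize m 1 = v at hm
  subst hm
  by_cases h : 1 < u + v
  · rw [coeff_eq_zero_of_totalDegree_lt]
    · have h0 : Finsupp.single (0 : Fin 2) 1 ≠ Finsupp.single 0 u + Finsupp.single 1 v := by
        intro h'
        have h0 := DFunLike.congr_fun h' 0
        have h1 := DFunLike.congr_fun h' 1
        simp at h0 h1
        omega
      have h1 : Finsupp.single (1 : Fin 2) 1 ≠ Finsupp.single 0 u + Finsupp.single 1 v := by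
        intro h'
        have h0 := DFunLike.congr_fun h' 0
        have h1 := DFunLike.congr_fun h' 1
        simp at h0 h1
        omega
      have h2 : (0 : Fin 2 →₀ ℕ) ≠ Finsupp.single 0 u + Finsupp.single 1 v := by
        intro h'
        have h0 := DFunLike.congr_fun h' 0
        have h1 := DFunLike.congr_fun h' 1
        simp at h0 h1
        omega
      simp [coeff_C_mul, coeff_X, coeff_C, h0, h1, h2]
    · refine hp.trans_lt (h.trans_eq ?_)
      change _ = Finsupp.degree _
      simp
  · have h01 : Finsupp.single (0 : Fin 2) 1 ≠ Finsupp.single (1 : Fin 2) 1 := by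
      simp [Finsupp.single_eq_single_iff]
    obtain ⟨rfl, rfl⟩ | ⟨rfl, rfl⟩ | ⟨rfl, rfl⟩ :
        (u = 0 ∧ v = 0) ∨ (u = 1 ∧ v = 0) ∨ (u = 0 ∧ v = 1) := by omega
    all_goals simp [coeff_C_mul, coeff_X, coeff_C, h01, h01.symm, eq_comm (a := (0 : Fin 2 →₀ ℕ))]

lemma exists_sq_eq_one_mul_nonneg (r : ℝ) : ∃ σ : ℝ, σ ^ 2 = 1 ∧ 0 ≤ σ * r := by
  rcases le_total 0 r with h | h
  · exact ⟨1, by norm_num, by linarith⟩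
  · exact ⟨-1, by norm_num, by linarith⟩

lemma exists_cube_eq (d : ℝ) : ∃ s : ℝ, s ^ 3 = d := by
  obtain ⟨τ, hτ, h⟩ := exists_sq_eq_one_mul_nonneg d
  refine ⟨τ * (τ * d) ^ ((3 : ℕ) : ℝ)⁻¹, ?_⟩
  rw [mul_pow, Real.rpow_inv_natCast_pow h three_ne_zero]
  linear_combination (τ ^ 2 + 1) * d * hτ

lemma exists_sq_eq_abs_div_cube_nonneg (b d : ℝ) :
    ∃ s : ℝ, s ^ 2 = |b| ∧ 0 ≤ d / s ^ 3 := by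
  obtain ⟨τ, hτ, h⟩ := exists_sq_eq_one_mul_nonneg d
  have hb : √|b| ^ 2 = |b| := Real.sq_sqrt (abs_nonneg b)
  refine ⟨τ * √|b|, by rw [mul_pow, hτ, hb, one_mul], ?_⟩
  have hτ0 : τ ≠ 0 := by rintro rfl; norm_num at hτ
  have : d / (τ * √|b|) ^ 3 = τ * d / √|b| ^ 3 := by
    have h4 : τ ^ 3 = τ := by linear_combination τ * hτ
    rw [mul_pow, h4]
    have : d / τ = τ * d := by field_simp; linear_combination -d * hτ
    rw [← div_div, this]
  rw [this]
  positivity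

lemma abs_div_self_or {b : ℝ} (hb : b ≠ 0) : b / |b| = 1 ∨ b / |b| = -1 := by
  rcases lt_or_gt_of_ne hb with h | h
  · right; rw [abs_of_neg h]; field_simp
  · left; rw [abs_of_pos h]; field_simp

/-- A cubic with neither an `xy` nor a `y²` term is brought to a form in the table by a
rescaling `x ↦ s x`, `y ↦ ± s y`. -/
lemma exists_scaling_famA (e a b d : ℝ) : ∃ s σ : ℝ, s ≠ 0 ∧ σ ^ 2 = 1 ∧
    FamA (X 0 ^ 3 + X 0 * X 1 ^ 2 + C (e / s) * X 0 ^ 2 + C (a / s ^ 2) * X 0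
      + C (σ * b / s ^ 2) * X 1 + C (d / s ^ 3)) := by
  by_cases he : e = 0
  · subst he
    by_cases hb : b = 0
    · subst hb
      by_cases ha : a = 0
      · subst ha
        by_cases hd : d = 0
        · subst hd
          exact ⟨1, 1, one_ne_zero, one_pow 2, .inr <| .inr <| .inr <| .inr (by simp)⟩
        · obtain ⟨s, hs⟩ : ∃ s : ℝ, s ^ 3 = d := exists_cube_eq d
          have hs0 : s ≠ 0 := by rintro rfl; exact hd (by rw [← hs]; norm_num)
          exact ⟨s, 1, hs0, one_pow 2, .inr <| .inr <| .inr <| .inl (by simp [hs, hd])⟩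
      · obtain ⟨s, hs, hd⟩ := exists_sq_eq_abs_div_cube_nonneg a d
        have hs0 : s ≠ 0 := by rintro rfl; exact ha (abs_eq_zero.1 (by rw [← hs]; norm_num))
        exact ⟨s, 1, hs0, one_pow 2, .inr <| .inr <| .inl
          ⟨a / |a|, d / s ^ 3, abs_div_self_or ha, hd, by simp [hs]⟩⟩
    · obtain ⟨s, hs, hd⟩ := exists_sq_eq_abs_div_cube_nonneg b d
      have hs0 : s ≠ 0 := by rintro rfl; exact hb (abs_eq_zero.1 (by rw [← hs]; norm_num))
      have hσ : (b / |b|) ^ 2 = 1 := by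
        rcases abs_div_self_or hb with h | h <;> rw [h] <;> norm_num
      have h1 : b / |b| * b / s ^ 2 = 1 := by
        rw [hs, mul_div_assoc, ← pow_two, hσ]
      refine ⟨s, b / |b|, hs0, hσ, .inr <| .inl ⟨a / s ^ 2, d / s ^ 3, hd, ?_⟩⟩
      rw [h1, zero_div, C_0, C_1]
      ring
  · obtain ⟨σ, hσ, h⟩ := exists_sq_eq_one_mul_nonneg b
    exact ⟨e, σ, he, hσ, .inl ⟨a / e ^ 2, σ * b / e ^ 2, d / e ^ 3, by positivity, by simp [he]⟩⟩

theorem stmt0 (E F G : ℝ) (lam : P2) (hlam : lam.totalDegree ≤ 1) :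
    ∃ g : P2, FamA g ∧
      AffEquiv (X 0 ^ 3 + X 0 * X 1 ^ 2 + C E * X 0 ^ 2 + C F * X 0 * X 1
        + C G * X 1 ^ 2 + lam) g := by
  obtain ⟨a, b, d, rfl⟩ := exists_eq_of_totalDegree_le_one hlam
  -- The translation `x ↦ x - G`, `y ↦ y - F / 2` removes the `xy` and `y²` terms.
  obtain ⟨s, σ, hs, hσ, hg⟩ := exists_scaling_famA (E - 3 * G)
    (3 * G ^ 2 - F ^ 2 / 4 - 2 * E * G + a) (b - G * F)
    (-G ^ 3 + E * G ^ 2 + F ^ 2 * G / 2 - a * G - b * F / 2 + d)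
  have hσ0 : σ ≠ 0 := by rintro rfl; norm_num at hσ
  refine ⟨_, hg, .of_diagAffine (s := s) (p := -G) (t := σ * s) (q := -(F / 2)) (c := s ^ 3)
    hs (mul_ne_zero hσ0 hs) (pow_ne_zero 3 hs) ?_⟩
  apply MvPolynomial.funext
  intro v
  simp only [map_add, map_mul, map_pow, diagAffine_X_zero, diagAffine_X_one, diagAffine_C,
    eval_C, eval_X]
  field_simp
  linear_combination 16 * s ^ 3 * v 0 * v 1 ^ 2 * hσ
end

section
/- Let f ∈ ℝ[x,y] be of the form x³ − x·y² + E·x² + F·x·y + G·y² + λ, where E, F, G ∈ ℝ and λ ∈ ℝ[x,y] has total degree at most 1. Then there exist an affine automorphism θ ∈ Γ₂(ℝ) and a nonzero real number c such that θ(f) = c·g, where g is one of the following polynomials: x³ − x·y² − y² + H·x + I·y + J with J ∈ ℝ, I ≥ 0, and H + I ≤ −3/4; x³ − x·y² − y + H·x + J with J ≥ 0 and −1 ≤ H ≤ 1; x³ − x·y² + 1; or x³ − x·y². -/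
open MvPolynomial

/-- The table entries with canonical form `x³ - x·y²`. -/
def FamB (p : P2) : Prop :=
  (∃ H I J : ℝ, 0 ≤ I ∧ H + I ≤ -(3/4 : ℝ) ∧
    p = X 0 ^ 3 - X 0 * X 1 ^ 2 - X 1 ^ 2 + C H * X 0 + C I * X 1 + C J) ∨
  (∃ H J : ℝ, 0 ≤ J ∧ -1 ≤ H ∧ H ≤ 1 ∧
    p = X 0 ^ 3 - X 0 * X 1 ^ 2 - X 1 + C H * X 0 + C J) ∨
  p = X 0 ^ 3 - X 0 * X 1 ^ 2 + 1 ∨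
  p = X 0 ^ 3 - X 0 * X 1 ^ 2

/-- The real affine polynomial `p x + q y + u`. -/
noncomputable def linPoly (p q u : ℝ) : P2 := C p * X 0 + C q * X 1 + C u

lemma totalDegree_linPoly_le (p q u : ℝ) : (linPoly p q u).totalDegree ≤ 1 := by
  have hX : ∀ (a : ℝ) (i : Fin 2), (C a * X i : P2).totalDegree ≤ 1 := fun a i => by
    refine (totalDegree_mul _ _).trans ?_
    simp [totalDegree_C, totalDegree_X]
  refine (totalDegree_add _ _).trans (max_le ((totalDegree_add _ _).trans ?_) ?_)
  · exact max_le (hX p 0) (hX q 1)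
  · simp [totalDegree_C]

lemma exists_eq_linPoly (f : P2) (hf : f.totalDegree ≤ 1) :
    ∃ p q u : ℝ, f = linPoly p q u := by
  refine ⟨coeff (Finsupp.single 0 1) f, coeff (Finsupp.single 1 1) f, coeff 0 f, ?_⟩
  have hsum : ∀ n : Fin 2 →₀ ℕ, (n.sum fun _ e => e) = n 0 + n 1 := fun n => by
    rw [Finsupp.sum_fintype _ _ (fun _ => rfl), Fin.sum_univ_two]
  ext n
  by_cases hn : n 0 + n 1 ≤ 1
  · have hcases : n = 0 ∨ n = Finsupp.single 0 1 ∨ n = Finsupp.single 1 1 := by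
      have : (n 0 = 0 ∧ n 1 = 0) ∨ (n 0 = 1 ∧ n 1 = 0) ∨ (n 0 = 0 ∧ n 1 = 1) := by omega
      rcases this with ⟨h0, h1⟩ | ⟨h0, h1⟩ | ⟨h0, h1⟩
      · left; ext i; fin_cases i <;> simp [h0, h1]
      · right; left; ext i; fin_cases i <;> simp [h0, h1]
      · right; right; ext i; fin_cases i <;> simp [h0, h1]
    rcases hcases with rfl | rfl | rfl <;>
      simp [linPoly, coeff_C_mul, coeff_X, coeff_C, Finsupp.single_eq_single_iff, eq_comm]
  · have vanish : ∀ g : P2, g.totalDegree ≤ 1 → coeff n g = 0 := fun g hg => by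
      by_contra hc
      have := le_totalDegree (mem_support_iff.mpr hc)
      rw [hsum] at this
      omega
    rw [vanish _ hf, vanish _ (totalDegree_linPoly_le _ _ _)]

/-- The variant of `AffEquiv` in which the automorphism is `ℝ`-linear by construction. -/
def LinAffEquiv (f g : P2) : Prop :=
  ∃ θ : P2 ≃ₐ[ℝ] P2, (θ (X 0)).totalDegree ≤ 1 ∧ (θ (X 1)).totalDegree ≤ 1 ∧
    ∃ c : ℝ, c ≠ 0 ∧ θ f = C c * g

lemma LinAffEquiv.affEquiv {f g : P2} (h : LinAffEquiv f g) : AffEquiv f g := by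
  obtain ⟨θ, h0, h1, c, hc, h⟩ := h
  exact ⟨θ.toRingEquiv, h0, h1, c, hc, h⟩

lemma algEquiv_C (θ : P2 ≃ₐ[ℝ] P2) (a : ℝ) : θ (C a) = C a := θ.commutes a

lemma totalDegree_algEquiv_le {θ : P2 ≃ₐ[ℝ] P2} (h0 : (θ (X 0)).totalDegree ≤ 1)
    (h1 : (θ (X 1)).totalDegree ≤ 1) {f : P2} (hf : f.totalDegree ≤ 1) :
    (θ f).totalDegree ≤ 1 := by
  obtain ⟨p, q, u, rfl⟩ := exists_eq_linPoly f hf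
  obtain ⟨p₀, q₀, u₀, e0⟩ := exists_eq_linPoly _ h0
  obtain ⟨p₁, q₁, u₁, e1⟩ := exists_eq_linPoly _ h1
  have : θ (linPoly p q u) =
      linPoly (p * p₀ + q * p₁) (p * q₀ + q * q₁) (p * u₀ + q * u₁ + u) := by
    simp only [linPoly, map_add, map_mul, algEquiv_C] at *
    rw [e0, e1]
    ring
  rw [this]
  exact totalDegree_linPoly_le _ _ _

lemma LinAffEquiv.trans {f g h : P2} (h₁ : LinAffEquiv f g) (h₂ : LinAffEquiv g h) :
    LinAffEquiv f h := by
  obtain ⟨θ, h0, h1, c, hc, e⟩ := h₁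
  obtain ⟨φ, k0, k1, d, hd, e'⟩ := h₂
  refine ⟨θ.trans φ, totalDegree_algEquiv_le k0 k1 h0, totalDegree_algEquiv_le k0 k1 h1,
    c * d, mul_ne_zero hc hd, ?_⟩
  rw [AlgEquiv.trans_apply, e, map_mul, algEquiv_C, e', C_mul, mul_assoc]

/-- Substituting an invertible affine change of coordinates gives an affine equivalence. -/
lemma LinAffEquiv.of_aeval {f g : P2} (p q u r s v c : ℝ) (hdet : p * s - q * r ≠ 0)
    (hc : c ≠ 0) (h : aeval ![linPoly p q u, linPoly r s v] f = C c * g) :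
    LinAffEquiv f g := by
  obtain ⟨d, hd⟩ : ∃ d : ℝ, d * (p * s - q * r) = 1 := ⟨_, inv_mul_cancel₀ hdet⟩
  have hC : (C d * (C p * C s - C q * C r) : P2) = 1 := by
    rw [← C_mul, ← C_mul, ← C_sub, ← C_mul, hd, C_1]
  let θ : P2 ≃ₐ[ℝ] P2 := AlgEquiv.ofAlgHom
    (aeval ![linPoly p q u, linPoly r s v])
    (aeval ![linPoly (d * s) (-(d * q)) (d * (q * v - s * u)),
      linPoly (-(d * r)) (d * p) (d * (r * u - p * v))])
    (by
      ext i : 1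
      fin_cases i
      · simp [linPoly, algHom_C, algebraMap_eq]
        linear_combination (X 0) * hC
      · simp [linPoly, algHom_C, algebraMap_eq]
        linear_combination (X 1) * hC)
    (by
      ext i : 1
      fin_cases i
      · simp [linPoly, algHom_C, algebraMap_eq]
        linear_combination (X 0 - C u) * hC
      · simp [linPoly, algHom_C, algebraMap_eq]
        linear_combination (X 1 - C v) * hC)
  have hθ : ∀ f, θ f = aeval ![linPoly p q u, linPoly r s v] f := fun _ => rfl
  refine ⟨θ, ?_, ?_, c, hc, (hθ f).trans h⟩
  · rw [hθ, aeval_X]; exact totalDegree_linPoly_le _ _ _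
  · rw [hθ, aeval_X]; exact totalDegree_linPoly_le _ _ _

/-- The general cubic with leading form `x³ - x y²`. -/
noncomputable def cubic (E F G a b c : ℝ) : P2 :=
  X 0 ^ 3 - X 0 * X 1 ^ 2 + C E * X 0 ^ 2 + C F * X 0 * X 1 + C G * X 1 ^ 2 + linPoly a b c

lemma cubic_translate (E F G a b c s t : ℝ) :
    LinAffEquiv (cubic E F G a b c)
      (cubic (E + 3 * s) (F - 2 * t) (G - s)
        (a + 3 * s ^ 2 - t ^ 2 + 2 * E * s + F * t) (b - 2 * s * t + F * s + 2 * G * t)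
        (s ^ 3 - s * t ^ 2 + E * s ^ 2 + F * s * t + G * t ^ 2 + a * s + b * t + c)) := by
  refine .of_aeval 1 0 s 0 1 t 1 (by norm_num) one_ne_zero ?_
  refine MvPolynomial.funext fun z => ?_
  simp [cubic, linPoly, algHom_C, algebraMap_eq]
  ring

lemma cubic_scale (E F G a b c : ℝ) {k : ℝ} (hk : k ≠ 0) :
    LinAffEquiv (cubic E F G a b c)
      (cubic (E / k) (F / k) (G / k) (a / k ^ 2) (b / k ^ 2) (c / k ^ 3)) := by
  refine .of_aeval k 0 0 0 k 0 (k ^ 3) (by simpa using hk) (pow_ne_zero 3 hk) ?_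
  refine MvPolynomial.funext fun z => ?_
  simp [cubic, linPoly, algHom_C, algebraMap_eq]
  field_simp

/-- A cubic whose quadratic part `m (3x² + y²)` is invariant under the symmetries of
`x³ - x y²`. -/
noncomputable def symCubic (m a b c : ℝ) : P2 := cubic (3 * m) 0 m a b c

lemma symCubic_flip (m a b c : ℝ) :
    LinAffEquiv (symCubic m a b c) (symCubic m a (-b) c) := by
  refine .of_aeval 1 0 0 0 (-1) 0 1 (by norm_num) one_ne_zero ?_
  simp [symCubic, cubic, linPoly, algHom_C, algebraMap_eq]

/-- The reflection exchanging the lines `x = 0` and `x + y = 0`. -/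
lemma symCubic_reflect (m a b c : ℝ) :
    LinAffEquiv (symCubic m a b c)
      (symCubic m ((-3 * b - a) / 2) ((b - a) / 2) c) := by
  refine .of_aeval (-(1 / 2)) (-(1 / 2)) 0 (-(3 / 2)) (1 / 2) 0 1 (by norm_num) one_ne_zero ?_
  refine MvPolynomial.funext fun z => ?_
  simp [symCubic, cubic, linPoly, algHom_C, algebraMap_eq]
  ring

lemma exists_chamber_left (m a b c : ℝ) :
    ∃ a' b', 0 ≤ b' ∧ a' + b' ≤ 0 ∧ LinAffEquiv (symCubic m a b c) (symCubic m a' b' c) := by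
  wlog hb : 0 ≤ b generalizing b
  · obtain ⟨a', b', h1, h2, h⟩ := this (-b) (by linarith)
    exact ⟨a', b', h1, h2, (symCubic_flip m a b c).trans h⟩
  have hr := symCubic_reflect m a b c
  rcases le_total (a + b) 0 with h | h
  · exact ⟨a, b, hb, h, by simpa using (symCubic_flip m a b c).trans (symCubic_flip m a (-b) c)⟩
  rcases le_total a b with h' | h'
  · exact ⟨(-3 * b - a) / 2, (b - a) / 2, by linarith, by linarith, hr⟩
  · exact ⟨(-3 * b - a) / 2, -((b - a) / 2), by linarith, by linarith, hr.trans (symCubic_flip _ _ _ _)⟩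

lemma exists_chamber_down (m a b c : ℝ) :
    ∃ a' b', b' ≤ a' ∧ a' ≤ -b' ∧ LinAffEquiv (symCubic m a b c) (symCubic m a' b' c) := by
  obtain ⟨a', b', h1, h2, h⟩ := exists_chamber_left m a b c
  exact ⟨(-3 * b' - a') / 2, -((b' - a') / 2), by linarith, by linarith,
    (h.trans (symCubic_reflect _ _ _ _)).trans (symCubic_flip _ _ _ _)⟩

lemma exists_symCubic (E F G a b c : ℝ) :
    ∃ m a' b' c', LinAffEquiv (cubic E F G a b c) (symCubic m a' b' c') := by
  have h := cubic_translate E F G a b c ((3 * G - E) / 6) (F / 2)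
  have e1 : E + 3 * ((3 * G - E) / 6) = 3 * (G - (3 * G - E) / 6) := by ring
  have e2 : F - 2 * (F / 2) = 0 := by ring
  rw [e1, e2] at h
  exact ⟨_, _, _, _, h⟩

lemma exists_famB_of_ne_zero {m : ℝ} (hm : m ≠ 0) (a b c : ℝ) :
    ∃ g, FamB g ∧ LinAffEquiv (symCubic m a b c) g := by
  have hk : -2 * m ≠ 0 := mul_ne_zero (by norm_num) hm
  have h1 := cubic_scale (3 * m) 0 m a b c hk
  have e : 3 * m / (-2 * m) = 3 * (-1 / 2) := by field_simp
  have e' : m / (-2 * m) = -1 / 2 := by field_simp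
  rw [e, e', zero_div] at h1
  obtain ⟨a', b', hb, hab, h2⟩ :=
    exists_chamber_left (-1 / 2) (a / (-2 * m) ^ 2) (b / (-2 * m) ^ 2) (c / (-2 * m) ^ 3)
  have h3 := cubic_translate (3 * (-1 / 2)) 0 (-1 / 2) a' b' (c / (-2 * m) ^ 3) (1 / 2) 0
  refine ⟨_, Or.inl ⟨a' - 3 / 4, b', a' / 2 - 1 / 4 + c / (-2 * m) ^ 3, hb, by linarith, ?_⟩,
    (h1.trans h2).trans h3⟩
  refine MvPolynomial.funext fun z => ?_
  simp [cubic, linPoly]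
  ring

lemma exists_cube_eq_s1 (c : ℝ) : ∃ k : ℝ, k ^ 3 = c := by
  have h : |c| ≤ (|c| + 1) ^ 3 := by nlinarith [abs_nonneg c, pow_nonneg (abs_nonneg c) 3]
  refine mem_range_of_exists_le_of_exists_ge (f := fun k : ℝ => k ^ 3) (by fun_prop)
    ⟨-(|c| + 1), ?_⟩ ⟨|c| + 1, (le_abs_self c).trans h⟩
  have e : (-(|c| + 1)) ^ 3 = -(|c| + 1) ^ 3 := by ring
  simp only [e]
  linarith [neg_abs_le c]

lemma exists_famB_of_eq_zero (a b c : ℝ) :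
    ∃ g, FamB g ∧ LinAffEquiv (symCubic 0 a b c) g := by
  obtain ⟨a', b', h1, h2, h⟩ := exists_chamber_down 0 a b c
  have hs : ∀ {k : ℝ}, k ≠ 0 → LinAffEquiv (symCubic 0 a b c)
      (symCubic 0 (a' / k ^ 2) (b' / k ^ 2) (c / k ^ 3)) := fun {k} hk => by
    have := cubic_scale (3 * 0) 0 0 a' b' c hk
    simp only [mul_zero, zero_div] at this
    exact h.trans (by simpa [symCubic] using this)
  rcases (show b' ≤ 0 by linarith).eq_or_lt with hb | hb
  · obtain rfl : a' = 0 := by linarith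
    subst hb
    rcases eq_or_ne c 0 with rfl | hc
    · exact ⟨_, Or.inr (Or.inr (Or.inr (by simp [symCubic, cubic, linPoly]))), h⟩
    · obtain ⟨k, rfl⟩ : ∃ k : ℝ, k ^ 3 = c := exists_cube_eq_s1 c
      have hk : k ≠ 0 := by rintro rfl; simp at hc
      exact ⟨_, Or.inr (Or.inr (Or.inl (by simp [symCubic, cubic, linPoly, hk]))), hs hk⟩
  · obtain ⟨k, hk, hkc⟩ : ∃ k : ℝ, k ^ 2 = -b' ∧ 0 ≤ c / k ^ 3 := by
      have hq : Real.sqrt (-b') ^ 2 = -b' := Real.sq_sqrt (by linarith)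
      rcases le_total 0 c with hc | hc
      · exact ⟨_, hq, by positivity⟩
      · refine ⟨-Real.sqrt (-b'), by rw [neg_sq, hq], div_nonneg_of_nonpos hc ?_⟩
        rw [Odd.neg_pow (by decide)]
        have : 0 ≤ Real.sqrt (-b') ^ 3 := by positivity
        linarith
    have hk0 : k ≠ 0 := by rintro rfl; norm_num at hk; linarith
    refine ⟨_, Or.inr (Or.inl ⟨a' / k ^ 2, c / k ^ 3, hkc, ?_, ?_, ?_⟩), hs hk0⟩
    · rw [hk, le_div_iff₀ (by linarith)]; linarith
    · rw [hk, div_le_iff₀ (by linarith)]; linarith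
    · have : b' / k ^ 2 = -1 := by rw [hk, div_neg, div_self hb.ne]
      rw [this, symCubic, cubic, linPoly]
      simp only [mul_zero, C_0, C_neg, C_1]
      ring

theorem stmt1 (E F G : ℝ) (lam : P2) (hlam : lam.totalDegree ≤ 1) :
    ∃ g : P2, FamB g ∧
      AffEquiv (X 0 ^ 3 - X 0 * X 1 ^ 2 + C E * X 0 ^ 2 + C F * X 0 * X 1
        + C G * X 1 ^ 2 + lam) g := by
  obtain ⟨a, b, c, rfl⟩ := exists_eq_linPoly lam hlam
  obtain ⟨m, a', b', c', h⟩ := exists_symCubic E F G a b c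
  obtain ⟨g, hg, h'⟩ : ∃ g, FamB g ∧ LinAffEquiv (symCubic m a' b' c') g := by
    rcases eq_or_ne m 0 with rfl | hm
    · exact exists_famB_of_eq_zero a' b' c'
    · exact exists_famB_of_ne_zero hm a' b' c'
  exact ⟨g, hg, (h.trans h').affEquiv⟩
end

section
/- Let f and g each belong to the following family of polynomials in ℝ[x,y]: x³ + x·y² + x² + H·x + I·y + J with H, J ∈ ℝ and I ≥ 0; x³ + x·y² + y + H·x + J with H ∈ ℝ and J ≥ 0; x³ + x·y² + ε·x + J with ε ∈ {1, −1} and J ≥ 0; x³ + x·y² + 1; x³ + x·y². If f ∼ g, then f = g. -/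
open MvPolynomial

/-- A real bivariate cubic function that vanishes identically has zero coefficients. -/
lemma cubic_coeffs_eq_zero {a₃₀ a₂₁ a₁₂ a₀₃ a₂₀ a₁₁ a₀₂ a₁₀ a₀₁ a₀₀ : ℝ}
    (h : ∀ u v : ℝ, a₃₀ * u ^ 3 + a₂₁ * (u ^ 2 * v) + a₁₂ * (u * v ^ 2) + a₀₃ * v ^ 3
      + a₂₀ * u ^ 2 + a₁₁ * (u * v) + a₀₂ * v ^ 2 + a₁₀ * u + a₀₁ * v + a₀₀ = 0) :
    a₃₀ = 0 ∧ a₂₁ = 0 ∧ a₁₂ = 0 ∧ a₀₃ = 0 ∧ a₂₀ = 0 ∧ a₁₁ = 0 ∧ a₀₂ = 0 ∧ a₁₀ = 0 ∧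
      a₀₁ = 0 ∧ a₀₀ = 0 := by
  have h₀₀ := h 0 0
  have h₁₀ := h 1 0
  have h₂₀ := h (-1) 0
  have h₃₀ := h 2 0
  have h₀₁ := h 0 1
  have h₀₂ := h 0 (-1)
  have h₀₃ := h 0 2
  have h₁₁ := h 1 1
  have h₁₂ := h 1 (-1)
  have h₂₁ := h (-1) 1
  norm_num at h₀₀ h₁₀ h₂₀ h₃₀ h₀₁ h₀₂ h₀₃ h₁₁ h₁₂ h₂₁
  refine ⟨?_, ?_, ?_, ?_, ?_, ?_, ?_, ?_, ?_, ?_⟩ <;> linarith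

/-- A bivariate polynomial of total degree at most one is an affine form. -/
lemma exists_eq_affine_of_totalDegree_le_one {p : P2} (hp : p.totalDegree ≤ 1) :
    ∃ a b r : ℝ, p = C a * X 0 + C b * X 1 + C r := by
  refine ⟨coeff (Finsupp.single 0 1) p, coeff (Finsupp.single 1 1) p, coeff 0 p, ?_⟩
  ext m
  simp only [coeff_add, coeff_C_mul, coeff_X, coeff_C]
  by_cases hm : 1 < m.degree
  · rw [coeff_eq_zero_of_totalDegree_lt (lt_of_le_of_lt hp hm)]
    have h0 : Finsupp.single 0 1 ≠ m := by rintro rfl; simp at hm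
    have h1 : Finsupp.single 1 1 ≠ m := by rintro rfl; simp at hm
    have h2 : 0 ≠ m := by rintro rfl; simp at hm
    simp [h0, h1, h2]
  · have hsum : m 0 + m 1 ≤ 1 := by
      simpa [Finsupp.degree_eq_sum] using hm
    have key : m = 0 ∨ m = Finsupp.single 0 1 ∨ m = Finsupp.single 1 1 := by
      rcases Nat.eq_zero_or_pos (m 0) with h0 | h0
      · rcases Nat.eq_zero_or_pos (m 1) with h1 | h1
        · left; ext i; fin_cases i <;> simp [h0, h1]
        · right; right; ext i; fin_cases i <;> simp [h0]; omega
      · right; left; ext i; fin_cases i <;> simp <;> omega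
    rcases key with rfl | rfl | rfl <;>
      simp [Finsupp.single_left_inj, eq_comm (a := (0 : Fin 2 →₀ ℕ))]

/-- Every ring automorphism of `ℝ[x,y]` fixes the constants. -/
lemma ringEquiv_apply_C (θ : P2 ≃+* P2) (a : ℝ) : θ (C a) = C a := by
  have hid : (constantCoeff.comp (θ : P2 →+* P2)).comp C = RingHom.id ℝ :=
    Subsingleton.elim _ _
  have ha : constantCoeff (θ (C a)) = a := congrArg (fun φ : ℝ →+* ℝ ↦ φ a) hid
  rcases eq_or_ne a 0 with rfl | h0
  · simp
  · have hu : IsUnit (θ (C a)) := ((isUnit_iff_ne_zero.mpr h0).map C).map θ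
    obtain ⟨b, -, hb⟩ := MvPolynomial.isUnit_iff_eq_C_of_isReduced.mp hu
    rw [hb, constantCoeff_C] at ha
    rw [hb, ha]

/-- The cubics whose leading form is `x³ + x·y²`, with no `x·y` or `y²` term. -/
noncomputable def reducedCubic (P H I J : ℝ) : P2 :=
  X 0 ^ 3 + X 0 * X 1 ^ 2 + C P * X 0 ^ 2 + C H * X 0 + C I * X 1 + C J

/-- Affine equivalences between reduced cubics are diagonal scalings. -/
lemma AffEquiv.reducedCubic_scaling {P H I J P' H' I' J' : ℝ}
    (h : AffEquiv (reducedCubic P H I J) (reducedCubic P' H' I' J')) :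
    ∃ a d : ℝ, a ≠ 0 ∧ d ^ 2 = a ^ 2 ∧ P = a * P' ∧ H = a ^ 2 * H' ∧
      I * d = a ^ 3 * I' ∧ J = a ^ 3 * J' := by
  obtain ⟨θ, hx, hy, k, hk, hθ⟩ := h
  obtain ⟨a, b, r, hx⟩ := exists_eq_affine_of_totalDegree_le_one hx
  obtain ⟨c, d, s, hy⟩ := exists_eq_affine_of_totalDegree_le_one hy
  simp only [reducedCubic, map_add, map_mul, map_pow, ringEquiv_apply_C, hx, hy] at hθ
  have hev (u v : ℝ) := congrArg (eval ![u, v]) hθ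
  simp only [map_add, map_mul, map_pow, eval_C, eval_X, Matrix.cons_val_zero,
    Matrix.cons_val_one] at hev
  obtain ⟨h₃₀, h₂₁, h₁₂, h₀₃, h₂₀, h₁₁, h₀₂, h₁₀, h₀₁, h₀₀⟩ := cubic_coeffs_eq_zero
    (a₃₀ := a ^ 3 + a * c ^ 2 - k)
    (a₂₁ := 3 * a ^ 2 * b + b * c ^ 2 + 2 * a * c * d)
    (a₁₂ := 3 * a * b ^ 2 + a * d ^ 2 + 2 * b * c * d - k)
    (a₀₃ := b ^ 3 + b * d ^ 2)
    (a₂₀ := 3 * a ^ 2 * r + r * c ^ 2 + 2 * a * c * s + P * a ^ 2 - k * P')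
    (a₁₁ := 6 * a * b * r + 2 * r * c * d + 2 * a * d * s + 2 * b * c * s + 2 * P * a * b)
    (a₀₂ := 3 * b ^ 2 * r + r * d ^ 2 + 2 * b * d * s + P * b ^ 2)
    (a₁₀ := 3 * a * r ^ 2 + a * s ^ 2 + 2 * r * c * s + 2 * P * a * r + H * a + I * c - k * H')
    (a₀₁ := 3 * b * r ^ 2 + b * s ^ 2 + 2 * r * d * s + 2 * P * b * r + H * b + I * d - k * I')
    (a₀₀ := r ^ 3 + r * s ^ 2 + P * r ^ 2 + H * r + I * s + J - k * J')
    (fun u v ↦ by linear_combination hev u v)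
  obtain rfl : b = 0 := by
    have : b * (b ^ 2 + d ^ 2) = 0 := by linear_combination h₀₃
    rcases mul_eq_zero.mp this with h | h
    · exact h
    · nlinarith [sq_nonneg b, sq_nonneg d]
  have hkd : k = a * d ^ 2 := by linear_combination -h₁₂
  have ha : a ≠ 0 := by rintro rfl; exact hk (by simpa using hkd)
  have hd : d ≠ 0 := by rintro rfl; exact hk (by simpa using hkd)
  obtain rfl : c = 0 := by simpa [ha, hd] using h₂₁
  obtain rfl : r = 0 := by simpa [ha, hd] using h₀₂
  obtain rfl : s = 0 := by simpa [ha, hd] using h₁₁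
  have hka : k = a ^ 3 := by linear_combination -h₃₀
  subst hka
  refine ⟨a, d, ha, ?_, ?_, ?_, ?_, ?_⟩
  · exact mul_left_cancel₀ ha (by linear_combination -hkd)
  · exact mul_left_cancel₀ (pow_ne_zero 2 ha) (by linear_combination h₂₀)
  · exact mul_left_cancel₀ ha (by linear_combination h₁₀)
  · linear_combination h₀₁
  · linear_combination h₀₀

/-- The members of the family, described through their coefficients. -/
lemma FamA.exists_reducedCubic {p : P2} (hp : FamA p) :
    ∃ P H I J : ℝ, p = reducedCubic P H I J ∧
      ((P = 1 ∧ 0 ≤ I) ∨ (P = 0 ∧ I = 1 ∧ 0 ≤ J) ∨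
        (P = 0 ∧ I = 0 ∧ (H = 1 ∨ H = -1) ∧ 0 ≤ J) ∨
        (P = 0 ∧ I = 0 ∧ H = 0 ∧ (J = 1 ∨ J = 0))) := by
  rcases hp with ⟨H, I, J, hI, rfl⟩ | ⟨H, J, hJ, rfl⟩ | ⟨e, J, he, hJ, rfl⟩ | rfl | rfl
  · exact ⟨1, H, I, J, by simp [reducedCubic], by simp [hI]⟩
  · exact ⟨0, H, 1, J, by simp only [reducedCubic, C_0, C_1]; ring, by simp [hJ]⟩
  · exact ⟨0, e, 0, J, by simp [reducedCubic], by simp [he, hJ]⟩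
  · exact ⟨0, 0, 0, 1, by simp [reducedCubic], by simp⟩
  · exact ⟨0, 0, 0, 0, by simp [reducedCubic], by simp⟩

lemma eq_of_nonneg_of_sq_eq_sq {x y : ℝ} (hx : 0 ≤ x) (hy : 0 ≤ y) (h : x ^ 2 = y ^ 2) :
    x = y :=
  (sq_eq_sq₀ hx hy).mp h

theorem stmt4 (f g : P2) (hf : FamA f) (hg : FamA g) (h : AffEquiv f g) :
    f = g := by
  obtain ⟨P, H, I, J, rfl, hf'⟩ := hf.exists_reducedCubic
  obtain ⟨P', H', I', J', rfl, hg'⟩ := hg.exists_reducedCubic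
  obtain ⟨a, d, ha, hd, hP, hH, hI, hJ⟩ := h.reducedCubic_scaling
  have ha2 : 0 < a ^ 2 := by positivity
  suffices P = P' ∧ H = H' ∧ I = I' ∧ J = J' by
    obtain ⟨rfl, rfl, rfl, rfl⟩ := this
    rfl
  have hP0 : P = 0 ↔ P' = 0 := by simp [hP, ha]
  have hH0 : H = 0 ↔ H' = 0 := by simp [hH, ha]
  have hJ0 : J = 0 ↔ J' = 0 := by simp [hJ, ha]
  have hI2 : I ^ 2 = (a ^ 2) ^ 2 * I' ^ 2 :=
    mul_left_cancel₀ ha2.ne' (by linear_combination (I * d + a ^ 3 * I') * hI - I ^ 2 * hd)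
  have hI0 : I = 0 ↔ I' = 0 := by
    rw [← sq_eq_zero_iff, hI2]; simp [ha]
  have hJ2 : J ^ 2 = (a ^ 2) ^ 3 * J' ^ 2 := by rw [hJ]; ring
  rcases hf' with ⟨rfl, hI_nonneg⟩ | ⟨rfl, rfl, hJ_nonneg⟩ | ⟨rfl, rfl, hH1, hJ_nonneg⟩ |
    ⟨rfl, rfl, rfl, hJ1⟩ <;>
  rcases hg' with ⟨rfl, hI'_nonneg⟩ | ⟨rfl, rfl, hJ'_nonneg⟩ | ⟨rfl, rfl, hH1', hJ'_nonneg⟩ |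
    ⟨rfl, rfl, rfl, hJ1'⟩ <;>
  try first | (norm_num at hP0; done) | (norm_num at hI0; done)
  · obtain rfl : a = 1 := by linarith
    exact ⟨rfl, by linarith, eq_of_nonneg_of_sq_eq_sq hI_nonneg hI'_nonneg (by linarith),
      by linarith⟩
  · have h1 : a ^ 2 = 1 := eq_of_nonneg_of_sq_eq_sq ha2.le zero_le_one (by linarith)
    rw [h1] at hH hJ2
    exact ⟨rfl, by linarith, rfl, eq_of_nonneg_of_sq_eq_sq hJ_nonneg hJ'_nonneg (by linarith)⟩
  · have h1 : a ^ 2 = 1 := by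
      rcases hH1 with rfl | rfl <;> rcases hH1' with rfl | rfl <;> linarith
    rw [h1] at hH hJ2
    exact ⟨rfl, by linarith, rfl, eq_of_nonneg_of_sq_eq_sq hJ_nonneg hJ'_nonneg (by linarith)⟩
  · rcases hH1 with rfl | rfl <;> norm_num at hH0
  · rcases hH1' with rfl | rfl <;> norm_num at hH0
  · refine ⟨rfl, rfl, rfl, ?_⟩
    rcases hJ1 with rfl | rfl <;> rcases hJ1' with rfl | rfl <;> first | rfl | norm_num at hJ0
end

section
/- Let f and g each belong to the following family of polynomials in ℝ[x,y]: x²·y + y² − x + I·y + J with I, J ∈ ℝ; x²·y + y² + ε·y + J with ε ∈ {1, −1} and J ∈ ℝ; x²·y + y² + ε with ε ∈ {1, −1}; x²·y + y²; x²·y − x + ε·y + J with ε ∈ {1, −1} and J ≥ 0; x²·y + ε·y + 1 with ε ∈ {1, −1}; x²·y + ε·y with ε ∈ {1, −1}; x²·y − x + 1; x²·y − x; x²·y − 1; x²·y. If f ∼ g, then f = g. -/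
open MvPolynomial

/-- The table entries with canonical form `x²·y`. -/
def FamC (p : P2) : Prop :=
  (∃ I J : ℝ, p = X 0 ^ 2 * X 1 + X 1 ^ 2 - X 0 + C I * X 1 + C J) ∨
  (∃ e J : ℝ, (e = 1 ∨ e = -1) ∧
    p = X 0 ^ 2 * X 1 + X 1 ^ 2 + C e * X 1 + C J) ∨
  (∃ e : ℝ, (e = 1 ∨ e = -1) ∧ p = X 0 ^ 2 * X 1 + X 1 ^ 2 + C e) ∨
  p = X 0 ^ 2 * X 1 + X 1 ^ 2 ∨
  (∃ e J : ℝ, (e = 1 ∨ e = -1) ∧ 0 ≤ J ∧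
    p = X 0 ^ 2 * X 1 - X 0 + C e * X 1 + C J) ∨
  (∃ e : ℝ, (e = 1 ∨ e = -1) ∧ p = X 0 ^ 2 * X 1 + C e * X 1 + 1) ∨
  (∃ e : ℝ, (e = 1 ∨ e = -1) ∧ p = X 0 ^ 2 * X 1 + C e * X 1) ∨
  p = X 0 ^ 2 * X 1 - X 0 + 1 ∨
  p = X 0 ^ 2 * X 1 - X 0 ∨
  p = X 0 ^ 2 * X 1 - 1 ∨
  p = X 0 ^ 2 * X 1

/-- The polynomial `x²·y + a·y² + b·x + e·y + j`. -/
noncomputable def cubicForm (a b e j : ℝ) : P2 :=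
  X 0 ^ 2 * X 1 + C a * X 1 ^ 2 + C b * X 0 + C e * X 1 + C j

/-- The coefficient tuples `(a, b, e, j)` for which `cubicForm a b e j` satisfies `FamC`. -/
def NormalCoeffs (a b e j : ℝ) : Prop :=
  (a = 1 ∧ b = -1) ∨
  (a = 1 ∧ b = 0 ∧ (e = 1 ∨ e = -1)) ∨
  (a = 1 ∧ b = 0 ∧ e = 0 ∧ (j = 1 ∨ j = -1 ∨ j = 0)) ∨
  (a = 0 ∧ b = -1 ∧ (e = 1 ∨ e = -1) ∧ 0 ≤ j) ∨
  (a = 0 ∧ b = -1 ∧ e = 0 ∧ (j = 1 ∨ j = 0)) ∨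
  (a = 0 ∧ b = 0 ∧ (e = 1 ∨ e = -1) ∧ (j = 1 ∨ j = 0)) ∨
  (a = 0 ∧ b = 0 ∧ e = 0 ∧ (j = -1 ∨ j = 0))

theorem FamC.exists_cubicForm {p : P2} (hp : FamC p) :
    ∃ a b e j : ℝ, p = cubicForm a b e j ∧ NormalCoeffs a b e j := by
  unfold cubicForm NormalCoeffs
  rcases hp with ⟨I, J, rfl⟩ | ⟨e, J, he, rfl⟩ | ⟨e, he, rfl⟩ | rfl | ⟨e, J, he, hJ, rfl⟩ |
    ⟨e, he, rfl⟩ | ⟨e, he, rfl⟩ | rfl | rfl | rfl | rfl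
  · exact ⟨1, -1, I, J, by simp only [map_neg, map_one]; ring, by simp⟩
  · exact ⟨1, 0, e, J, by simp only [map_zero, map_one]; ring, by simp [he]⟩
  · exact ⟨1, 0, 0, e, by simp only [map_zero, map_one]; ring, by rcases he with rfl | rfl <;> simp⟩
  · exact ⟨1, 0, 0, 0, by simp only [map_zero, map_one]; ring, by simp⟩
  · exact ⟨0, -1, e, J, by simp only [map_neg, map_zero, map_one]; ring, by simp [he, hJ]⟩
  · exact ⟨0, 0, e, 1, by simp only [map_zero, map_one]; ring, by simp [he]⟩
  · exact ⟨0, 0, e, 0, by simp only [map_zero]; ring, by simp [he]⟩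
  · exact ⟨0, -1, 0, 1, by simp only [map_neg, map_zero, map_one]; ring, by simp⟩
  · exact ⟨0, -1, 0, 0, by simp only [map_neg, map_zero, map_one]; ring, by simp⟩
  · exact ⟨0, 0, 0, -1, by simp only [map_neg, map_zero, map_one]; ring, by simp⟩
  · exact ⟨0, 0, 0, 0, by simp only [map_zero]; ring, by simp⟩

theorem ringEquiv_C (θ : P2 ≃+* P2) (r : ℝ) : θ (C r) = C r := by
  have hconst : ∀ s : ℝ, θ (C s) = C (constantCoeff (θ (C s))) := by
    intro s
    rcases eq_or_ne s 0 with rfl | hs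
    · simp
    · have hu : IsUnit (θ (C s)) := ((IsUnit.mk0 s hs).map (C : ℝ →+* P2)).map θ
      obtain ⟨t, -, ht⟩ := MvPolynomial.isUnit_iff_eq_C_of_isReduced.mp hu
      rw [ht, constantCoeff_C]
  have hid : ((constantCoeff.comp (θ : P2 →+* P2)).comp C : ℝ →+* ℝ) = RingHom.id ℝ :=
    Subsingleton.elim _ _
  have hr := RingHom.congr_fun hid r
  simp only [RingHom.comp_apply, RingHom.id_apply, RingHom.coe_coe] at hr
  rw [hconst r, hr]

theorem exists_affine_of_totalDegree_le_one {p : P2} (hp : p.totalDegree ≤ 1) :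
    ∃ a b c : ℝ, p = C a * X 0 + C b * X 1 + C c := by
  refine ⟨coeff (Finsupp.single 0 1) p, coeff (Finsupp.single 1 1) p, coeff 0 p, ?_⟩
  ext m
  by_cases hm : m.sum (fun _ k => k) ≤ 1
  · rw [Finsupp.sum_fintype _ _ (fun _ => rfl), Fin.sum_univ_two] at hm
    have hcases : m = 0 ∨ m = Finsupp.single 0 1 ∨ m = Finsupp.single 1 1 := by
      have h3 : (m 0 = 0 ∧ m 1 = 0) ∨ (m 0 = 1 ∧ m 1 = 0) ∨ (m 0 = 0 ∧ m 1 = 1) := by omega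
      rcases h3 with h | h | h
      · left; ext i; fin_cases i <;> simp [h]
      · right; left; ext i; fin_cases i <;> simp [h]
      · right; right; ext i; fin_cases i <;> simp [h]
    rcases hcases with rfl | rfl | rfl <;>
      simp [coeff_C_mul, coeff_X, coeff_C, Finsupp.single_left_inj, eq_comm]
  · have h0 : ∀ q : P2, q.totalDegree ≤ 1 → coeff m q = 0 := fun q hq => by
      by_contra hne
      exact hm ((le_totalDegree (mem_support_iff.mpr hne)).trans hq)
    rw [h0 p hp, h0]
    refine (totalDegree_add _ _).trans (max_le ((totalDegree_add _ _).trans (max_le ?_ ?_)) ?_)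
    · exact (totalDegree_mul _ _).trans (by simp)
    · exact (totalDegree_mul _ _).trans (by simp)
    · simp

/-- A real cubic polynomial function in two variables that vanishes identically has
zero coefficients. -/
theorem cubic_coeffs_eq_zero_s6 {k₁ k₂ k₃ k₄ k₅ k₆ k₇ k₈ k₉ k₀ : ℝ}
    (h : ∀ x y : ℝ, k₁ * x ^ 3 + k₂ * (x ^ 2 * y) + k₃ * (x * y ^ 2) + k₄ * y ^ 3 +
      k₅ * x ^ 2 + k₆ * (x * y) + k₇ * y ^ 2 + k₈ * x + k₉ * y + k₀ = 0) :
    k₁ = 0 ∧ k₂ = 0 ∧ k₃ = 0 ∧ k₄ = 0 ∧ k₅ = 0 ∧ k₆ = 0 ∧ k₇ = 0 ∧ k₈ = 0 ∧ k₉ = 0 ∧ k₀ = 0 := by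
  have h1 := h 0 0
  have h2 := h 1 0
  have h3 := h (-1) 0
  have h4 := h 2 0
  have h5 := h 0 1
  have h6 := h 0 (-1)
  have h7 := h 0 2
  have h8 := h 1 1
  have h9 := h 1 (-1)
  have h10 := h (-1) 1
  norm_num at h1 h2 h3 h4 h5 h6 h7 h8 h9 h10
  refine ⟨?_, ?_, ?_, ?_, ?_, ?_, ?_, ?_, ?_, ?_⟩ <;> linarith

/-- Affinely equivalent polynomials of the shape `cubicForm` are related by a rescaling
of the coordinates. -/
theorem AffEquiv.exists_scaling {a b e j a' b' e' j' : ℝ}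
    (h : AffEquiv (cubicForm a b e j) (cubicForm a' b' e' j')) :
    ∃ α β : ℝ, α ≠ 0 ∧ β ≠ 0 ∧ a * β = α ^ 2 * a' ∧ b = α * β * b' ∧ e = α ^ 2 * e' ∧
      j = α ^ 2 * β * j' := by
  obtain ⟨θ, h0, h1, c, hc, hθ⟩ := h
  obtain ⟨a0, a1, a2, hx⟩ := exists_affine_of_totalDegree_le_one h0
  obtain ⟨b0, b1, b2, hy⟩ := exists_affine_of_totalDegree_le_one h1
  simp only [cubicForm, map_add, map_mul, map_pow, ringEquiv_C, hx, hy] at hθ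
  have hev : ∀ x y : ℝ, (a0 * x + a1 * y + a2) ^ 2 * (b0 * x + b1 * y + b2) +
      a * (b0 * x + b1 * y + b2) ^ 2 + b * (a0 * x + a1 * y + a2) +
      e * (b0 * x + b1 * y + b2) + j =
      c * (x ^ 2 * y + a' * y ^ 2 + b' * x + e' * y + j') := by
    intro x y
    simpa using congrArg (eval ![x, y]) hθ
  obtain ⟨e1, e2, e3, e4, e5, e6, e7, e8, e9, e0⟩ := cubic_coeffs_eq_zero_s6
    (k₁ := a0 ^ 2 * b0) (k₂ := a0 ^ 2 * b1 + 2 * a0 * a1 * b0 - c)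
    (k₃ := a1 ^ 2 * b0 + 2 * a0 * a1 * b1) (k₄ := a1 ^ 2 * b1)
    (k₅ := a0 ^ 2 * b2 + 2 * a0 * a2 * b0 + a * b0 ^ 2)
    (k₆ := 2 * a0 * a1 * b2 + 2 * a0 * a2 * b1 + 2 * a1 * a2 * b0 + 2 * a * b0 * b1)
    (k₇ := a1 ^ 2 * b2 + 2 * a1 * a2 * b1 + a * b1 ^ 2 - c * a')
    (k₈ := a2 ^ 2 * b0 + 2 * a0 * a2 * b2 + 2 * a * b0 * b2 + b * a0 + e * b0 - c * b')
    (k₉ := a2 ^ 2 * b1 + 2 * a1 * a2 * b2 + 2 * a * b1 * b2 + b * a1 + e * b1 - c * e')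
    (k₀ := a2 ^ 2 * b2 + a * b2 ^ 2 + b * a2 + e * b2 + j - c * j')
    (fun x y => by linear_combination hev x y)
  have ha0 : a0 ≠ 0 := by
    rintro rfl
    exact hc (by linear_combination -e2)
  obtain rfl : b0 = 0 := by simpa [ha0] using e1
  obtain rfl : c = a0 ^ 2 * b1 := by linear_combination -e2
  have hb1 : b1 ≠ 0 := by
    rintro rfl
    simp at hc
  obtain rfl : a1 = 0 := by simpa [hb1] using e4
  obtain rfl : b2 = 0 := by simpa [ha0] using e5
  obtain rfl : a2 = 0 := by simpa [ha0, hb1] using e6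
  refine ⟨a0, b1, ha0, hb1, ?_, ?_, ?_, ?_⟩
  · exact mul_right_cancel₀ hb1 (by linear_combination e7)
  · exact mul_right_cancel₀ ha0 (by linear_combination e8)
  · exact mul_right_cancel₀ hb1 (by linear_combination e9)
  · linear_combination e0

theorem NormalCoeffs.eq_of_scaling {a b e j a' b' e' j' α β : ℝ}
    (h : NormalCoeffs a b e j) (h' : NormalCoeffs a' b' e' j') (hα : α ≠ 0) (hβ : β ≠ 0)
    (ha : a * β = α ^ 2 * a') (hb : b = α * β * b') (he : e = α ^ 2 * e')
    (hj : j = α ^ 2 * β * j') : a = a' ∧ b = b' ∧ e = e' ∧ j = j' := by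
  have hα2 : 0 < α ^ 2 := by positivity
  have haa : a = a' := by
    have h1 : a = 0 ∨ a = 1 := by unfold NormalCoeffs at h; tauto
    have h2 : a' = 0 ∨ a' = 1 := by unfold NormalCoeffs at h'; tauto
    have h3 : a = 0 ↔ a' = 0 := by
      simpa [hα, hβ] using iff_of_eq (congrArg (· = 0) ha)
    rcases h1 with rfl | rfl <;> rcases h2 with rfl | rfl <;> simp at h3 ⊢
  have hbb : b = b' := by
    have h1 : b = 0 ∨ b = -1 := by unfold NormalCoeffs at h; tauto
    have h2 : b' = 0 ∨ b' = -1 := by unfold NormalCoeffs at h'; tauto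
    have h3 : b = 0 ↔ b' = 0 := by
      simp [hb, hα, hβ]
    rcases h1 with rfl | rfl <;> rcases h2 with rfl | rfl <;> simp at h3 ⊢
  subst haa hbb
  have hsign : (e = 1 ∨ e = -1) → (e' = 1 ∨ e' = -1) → α ^ 2 = 1 ∧ e = e' := by
    rintro (rfl | rfl) (rfl | rfl) <;> constructor <;> linarith
  have hzero : e = 0 ↔ e' = 0 := by simp [he, hα]
  rcases h with ⟨rfl, rfl⟩ | ⟨rfl, rfl, h1⟩ | ⟨rfl, rfl, rfl, h1⟩ | ⟨rfl, rfl, h1, h2⟩ |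
    ⟨rfl, rfl, rfl, h1⟩ | ⟨rfl, rfl, h1, h2⟩ | ⟨rfl, rfl, rfl, h1⟩
  · have h3 : α ^ 3 = 1 := by
      have : β = α ^ 2 := by linarith
      subst this
      linarith
    have : α = 1 := by
      have h4 : (α - 1) * (α ^ 2 + α + 1) = 0 := by linear_combination h3
      rcases mul_eq_zero.mp h4 with h | h
      · linarith
      · nlinarith [sq_nonneg (α + 1 / 2)]
    subst this
    have : β = 1 := by linarith
    subst this
    exact ⟨rfl, rfl, by linarith, by linarith⟩
  · have he' : e' = 1 ∨ e' = -1 := by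
      have : e' ≠ 0 := by rcases h1 with rfl | rfl <;> simpa using hzero
      simp [NormalCoeffs] at h'
      tauto
    obtain ⟨h3, h4⟩ := hsign h1 he'
    have : β = 1 := by linarith
    simp [hj, h3, h4, this]
  · obtain rfl : e' = 0 := hzero.mp rfl
    simp [NormalCoeffs] at h'
    have hβ0 : 0 < β := by linarith
    refine ⟨rfl, rfl, rfl, ?_⟩
    have hpos : 0 < α ^ 2 * β := mul_pos hα2 hβ0
    rcases h1 with rfl | rfl | rfl <;> rcases h' with rfl | rfl | rfl <;> first | rfl | linarith
  · have he' : (e' = 1 ∨ e' = -1) ∧ 0 ≤ j' := by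
      have : e' ≠ 0 := by rcases h1 with rfl | rfl <;> simpa using hzero
      simp [NormalCoeffs] at h'
      tauto
    obtain ⟨h3, h4⟩ := hsign h1 he'.1
    have h5 : j = α * j' := by linear_combination hj + α * j' * hb
    refine ⟨rfl, rfl, h4, ?_⟩
    rcases eq_or_eq_neg_of_sq_eq_sq α 1 (by rw [h3, one_pow]) with rfl | rfl <;> linarith [he'.2]
  · obtain rfl : e' = 0 := hzero.mp rfl
    simp [NormalCoeffs] at h'
    refine ⟨rfl, rfl, rfl, ?_⟩
    have h3 : j = 0 ↔ j' = 0 := by simp [hj, hα, hβ]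
    rcases h1 with rfl | rfl <;> rcases h' with rfl | rfl <;> simp at h3 ⊢
  · have he' : (e' = 1 ∨ e' = -1) ∧ (j' = 1 ∨ j' = 0) := by
      have : e' ≠ 0 := by rcases h1 with rfl | rfl <;> simpa using hzero
      simp [NormalCoeffs] at h'
      tauto
    have h3 : j = 0 ↔ j' = 0 := by simp [hj, hα, hβ]
    refine ⟨rfl, rfl, (hsign h1 he'.1).2, ?_⟩
    rcases h2 with rfl | rfl <;> rcases he'.2 with rfl | rfl <;> simp at h3 ⊢
  · obtain rfl : e' = 0 := hzero.mp rfl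
    simp [NormalCoeffs] at h'
    refine ⟨rfl, rfl, rfl, ?_⟩
    have h3 : j = 0 ↔ j' = 0 := by simp [hj, hα, hβ]
    rcases h1 with rfl | rfl <;> rcases h' with rfl | rfl <;> simp at h3 ⊢

theorem stmt6 (f g : P2) (hf : FamC f) (hg : FamC g) (h : AffEquiv f g) :
    f = g := by
  obtain ⟨a, b, e, j, rfl, hn⟩ := hf.exists_cubicForm
  obtain ⟨a', b', e', j', rfl, hn'⟩ := hg.exists_cubicForm
  obtain ⟨α, β, hα, hβ, ha, hb, he, hj⟩ := h.exists_scaling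
  obtain ⟨rfl, rfl, rfl, rfl⟩ := hn.eq_of_scaling hn' hα hβ ha hb he hj
  rfl
end
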